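/- Let H be an m×n matrix over F₂ whose rows all have Hamming weight at most w, and let H̃ = [H_diag ∣ I_sdiag] be the r-multi-round parity-check matrix of H (block-diagonal copies of H augmented by a step-diagonal of m×m identity blocks). Then every row of H̃ has Hamming weight at most w + 2, every column of H̃ in the appended (syndrome) part has Hamming weight at most 2, and every column in the data part has the same Hamming weight as the corresponding column of H. In particular, if {H} is a family of LDPC parity-check matrices with row and column weights bounded by a constant, then the multi-round matrices H̃ have row and column weights bounded by a constant independent of the number of rounds r. -/

import Mathlib

open Matrix

theorem Finset.card_le_two_of_injOn {α β : Type*} [DecidableEq β] {s : Finset α} (f : α → β)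
    (a b : β) (hf : Set.InjOn f s) (h : ∀ x ∈ s, f x = a ∨ f x = b) : s.card ≤ 2 :=
  (Finset.card_le_card_of_injOn f (t := {a, b})
    (fun x hx => by simpa using h x hx) hf).trans Finset.card_le_two

theorem Finset.card_filter_prod_fst_eq {α β : Type*} [Fintype α] [Fintype β] [DecidableEq α]
    (a : α) (p : β → Prop) [DecidablePred p] (q : α × β → Prop) [DecidablePred q]
    (h : ∀ x y, q (x, y) ↔ x = a ∧ p y) :
    (Finset.univ.filter q).card = (Finset.univ.filter p).card := by
  have : Finset.univ.filter q = {a} ×ˢ Finset.univ.filter p := by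
    ext ⟨x, y⟩
    simp [h, and_comm, eq_comm]
  simp [this]

/-- The multi-round parity-check matrix of an LDPC matrix is LDPC: row weights increase
by at most 2, syndrome columns have weight at most 2, and data columns have the same
weight as the corresponding columns of `H`, independently of the number of rounds `r`. -/
theorem multiRound_matrix_is_LDPC
    (m n r w : ℕ)
    (H : Matrix (Fin m) (Fin n) (ZMod 2))
    (hHrow : ∀ i : Fin m, (Finset.univ.filter fun j : Fin n => H i j ≠ 0).card ≤ w)
    (Htilde : Matrix (Fin r × Fin m) ((Fin r × Fin n) ⊕ (Fin r × Fin m)) (ZMod 2))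
    (hdata : ∀ (t : Fin r) (c : Fin m) (t' : Fin r) (b : Fin n),
      Htilde (t, c) (Sum.inl (t', b)) = if t = t' then H c b else 0)
    (hsynd : ∀ (t : Fin r) (c : Fin m) (t' : Fin r) (c' : Fin m),
      Htilde (t, c) (Sum.inr (t', c')) =
        if c = c' then
          (if t = t' then 1 else 0) + (if (t : ℕ) = (t' : ℕ) + 1 then 1 else 0)
        else 0) :
    (∀ p : Fin r × Fin m,
      (Finset.univ.filter fun q : (Fin r × Fin n) ⊕ (Fin r × Fin m) =>
        Htilde p q ≠ 0).card ≤ w + 2) ∧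
    (∀ q : Fin r × Fin m,
      (Finset.univ.filter fun p : Fin r × Fin m => Htilde p (Sum.inr q) ≠ 0).card ≤ 2) ∧
    (∀ (t : Fin r) (b : Fin n),
      (Finset.univ.filter fun p : Fin r × Fin m => Htilde p (Sum.inl (t, b)) ≠ 0).card =
        (Finset.univ.filter fun i : Fin m => H i b ≠ 0).card) := by
  have hsupp : ∀ (t : Fin r) (c : Fin m) (t' : Fin r) (c' : Fin m),
      Htilde (t, c) (Sum.inr (t', c')) ≠ 0 →
        c = c' ∧ ((t : ℕ) = t' ∨ (t : ℕ) = (t' : ℕ) + 1) := by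
    intro t c t' c' h
    rw [hsynd] at h
    grind
  refine ⟨?_, ?_, ?_⟩
  · rintro ⟨t, c⟩
    rw [Finset.card_filter, Fintype.sum_sum_type, ← Finset.card_filter, ← Finset.card_filter]
    refine add_le_add ?_ ?_
    · rw [Finset.card_filter_prod_fst_eq t (fun j => H c j ≠ 0)]
      · exact hHrow c
      · intro t' b
        rw [hdata]
        grind
    · refine Finset.card_le_two_of_injOn (fun q => (q.1 : ℕ)) t ((t : ℕ) - 1) ?_ ?_
      · rintro ⟨x, y⟩ hx ⟨x', y'⟩ hx' he
        have h := (hsupp _ _ _ _ (Finset.mem_filter.mp hx).2).1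
        have h' := (hsupp _ _ _ _ (Finset.mem_filter.mp hx').2).1
        exact Prod.ext (Fin.ext he) (h.symm.trans h')
      · rintro ⟨x, y⟩ hx
        have h := (hsupp _ _ _ _ (Finset.mem_filter.mp hx).2).2
        dsimp only
        omega
  · rintro ⟨t, c⟩
    refine Finset.card_le_two_of_injOn (fun p => (p.1 : ℕ)) t ((t : ℕ) + 1) ?_ ?_
    · rintro ⟨x, y⟩ hx ⟨x', y'⟩ hx' he
      have h := (hsupp _ _ _ _ (Finset.mem_filter.mp hx).2).1
      have h' := (hsupp _ _ _ _ (Finset.mem_filter.mp hx').2).1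
      exact Prod.ext (Fin.ext he) (h.trans h'.symm)
    · rintro ⟨x, y⟩ hx
      exact (hsupp _ _ _ _ (Finset.mem_filter.mp hx).2).2
  · intro t b
    refine Finset.card_filter_prod_fst_eq t _ _ fun t' c => ?_
    rw [hdata]
    grind
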